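/- Let k and a be integers with 1 ≤ a ≤ k, k even, and a odd. For a nonnegative integer n, let OW_{k,a}(n) denote the number of partitions λ of n such that f_1(λ) ≤ a−1, f_i(λ)+f_{i+1}(λ) ≤ k−1 for every i ≥ 1, and every odd part appears an even number of times (i.e., f_{2j−1}(λ) is even for all j ≥ 1). Then for every complex number q with |q| < 1, ∑_{n ≥ 0} OW_{k,a}(n) q^n = ∑_{n_1,…,n_{k−1} ≥ 0} q^{N_1² + ⋯ + N_{k−1}² + n_1 + n_3 + ⋯ + n_{a−2} + N_a + N_{a+1} + ⋯ + N_{k−1}} / ((q²;q²)_{n_1} (q²;q²)_{n_2} ⋯ (q²;q²)_{n_{k−1}}), where n_1 + n_3 + ⋯ + n_{a−2} runs over odd subscripts up to a−2 (this list being empty if a = 1), and the sum converges absolutely. -/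

import Mathlib

open Finset

/-- Finite q-Pochhammer symbol `(x;q)_n`. -/
noncomputable def qPoch (q x : ℂ) (n : ℕ) : ℂ :=
  ∏ j ∈ Finset.range n, (1 - x * q ^ j)

/-- `Nsum m n i = n_i + n_{i+1} + ⋯ + n_m` (1-based), where `n : Fin m → ℕ` lists
`n_1, …, n_m`; in particular `Nsum m n i = 0` for `i > m`. -/
def Nsum (m : ℕ) (n : Fin m → ℕ) (i : ℕ) : ℕ :=
  ∑ j : Fin m, if i ≤ (j : ℕ) + 1 then n j else 0

/-- Summand of the multisum for `\overline{W}_{k,a}` with `k` even and `a` odd: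
exponent `N_1² + ⋯ + N_{k-1}² + n_1 + n_3 + ⋯ + n_{a-2} + N_a + N_{a+1} + ⋯ + N_{k-1}`
(note `n_i = N_i - N_{i+1}`), denominator `(q²;q²)_{n_1} ⋯ (q²;q²)_{n_{k-1}}`. -/
noncomputable def owTerm (k a : ℕ) (q : ℂ) (n : Fin (k - 1) → ℕ) : ℂ :=
  q ^ ((∑ i ∈ Finset.Icc 1 (k - 1), (Nsum (k - 1) n i) ^ 2) +
        (∑ i ∈ (Finset.Icc 1 (a - 2)).filter (fun i => i % 2 = 1),
          (Nsum (k - 1) n i - Nsum (k - 1) n (i + 1))) +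
        ∑ i ∈ Finset.Icc a (k - 1), Nsum (k - 1) n i) /
    ∏ j : Fin (k - 1), qPoch (q ^ 2) (q ^ 2) (n j)

lemma qPoch_succ (q x : ℂ) (n : ℕ) : qPoch q x (n + 1) = qPoch q x n * (1 - x * q ^ n) :=
  Finset.prod_range_succ _ _

lemma one_sub_pow_norm_le {q : ℂ} (hq : ‖q‖ < 1) (j : ℕ) :
    1 - ‖q‖ ≤ ‖1 - q ^ 2 * (q ^ 2) ^ j‖ := by
  have h1 : ‖q ^ 2 * (q ^ 2) ^ j‖ ≤ ‖q‖ := by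
    rw [← pow_succ', ← pow_mul, norm_pow]
    exact pow_le_of_le_one (norm_nonneg q) hq.le (by omega)
  have h2 := norm_sub_norm_le (1 : ℂ) (q ^ 2 * (q ^ 2) ^ j)
  rw [norm_one] at h2
  linarith

lemma qPoch_sq_ne_zero {q : ℂ} (hq : ‖q‖ < 1) (n : ℕ) : qPoch (q ^ 2) (q ^ 2) n ≠ 0 := by
  refine Finset.prod_ne_zero_iff.mpr fun j _ => ?_
  rw [← norm_pos_iff]
  exact lt_of_lt_of_le (by linarith) (one_sub_pow_norm_le hq j)

/-- The dominating sequence `|q|^{m²} / |(q²;q²)_m|`. -/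
noncomputable def gaussMajorant (q : ℂ) (m : ℕ) : ℝ :=
  ‖q‖ ^ (m ^ 2) / ‖qPoch (q ^ 2) (q ^ 2) m‖

lemma gaussMajorant_nonneg (q : ℂ) (m : ℕ) : 0 ≤ gaussMajorant q m := by
  unfold gaussMajorant; positivity

lemma summable_gaussMajorant {q : ℂ} (hq : ‖q‖ < 1) : Summable (gaussMajorant q) := by
  have hc : 0 < 1 - ‖q‖ := by linarith
  have hlim : Filter.Tendsto (fun m : ℕ => ‖q‖ ^ (2 * m + 1) / (1 - ‖q‖))
      Filter.atTop (nhds 0) := by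
    have h1 : Filter.Tendsto (fun m : ℕ => ‖q‖ ^ (2 * m + 1)) Filter.atTop (nhds 0) :=
      (tendsto_pow_atTop_nhds_zero_of_lt_one (norm_nonneg q) hq).comp
        (Filter.tendsto_atTop_mono (fun n => by simp only [id]; omega) Filter.tendsto_id)
    simpa using h1.div_const (1 - ‖q‖)
  refine summable_of_ratio_norm_eventually_le (r := 1 / 2) (by norm_num) ?_
  filter_upwards [hlim.eventually_le_const (show (0 : ℝ) < 1 / 2 by norm_num)] with m hm
  rw [Real.norm_of_nonneg (gaussMajorant_nonneg q _), Real.norm_of_nonneg (gaussMajorant_nonneg q _)]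
  unfold gaussMajorant
  have hP : 0 < ‖qPoch (q ^ 2) (q ^ 2) m‖ := norm_pos_iff.mpr (qPoch_sq_ne_zero hq m)
  have hf := one_sub_pow_norm_le hq m
  rw [qPoch_succ, norm_mul, show (m + 1) ^ 2 = (2 * m + 1) + m ^ 2 by ring, pow_add,
    mul_comm ‖qPoch _ _ _‖, mul_div_mul_comm]
  refine mul_le_mul_of_nonneg_right (le_trans ?_ hm) (by positivity)
  gcongr

/-- The coefficient of `m` in the exponent when a new smallest index `N_D = m` is adjoined. -/
def linCoeff (D a s : ℕ) : ℕ :=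
  if Even s then D - 2 * min ((a - 1) / 2) (D / 2) else 2 * ((D + 2 - a) / 2)

/-- The iterated `d`-fold sum, in which `s` records the specialization `x = q ^ s`. For even `s` it
is the generating function with odd parts of even multiplicity, for odd `s` the one with
even parts of even multiplicity. -/
noncomputable def levelSum (q : ℂ) : ℕ → ℕ → ℕ → ℂ
  | 0, a, _ => if a = 0 then 0 else 1
  | d + 1, a, s => ∑' m : ℕ, q ^ ((d + 1) * (m ^ 2 + s * m) + linCoeff (d + 1) a s * m) /
      qPoch (q ^ 2) (q ^ 2) m * levelSum q d a (s + 2 * m)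

lemma levelSum_zero_index (q : ℂ) (d s : ℕ) : levelSum q d 0 s = 0 := by
  induction d generalizing s with
  | zero => simp [levelSum]
  | succ d ih => simp [levelSum, ih]

lemma norm_div_qPoch_mul_le {q : ℂ} (hq : ‖q‖ < 1) {e m : ℕ} (he : m ^ 2 ≤ e) {z : ℂ} {M : ℝ}
    (hz : ‖z‖ ≤ M) :
    ‖q ^ e / qPoch (q ^ 2) (q ^ 2) m * z‖ ≤ gaussMajorant q m * M := by
  rw [norm_mul, norm_div, norm_pow]
  refine mul_le_mul ?_ hz (norm_nonneg z) (gaussMajorant_nonneg q m)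
  exact div_le_div_of_nonneg_right (pow_le_pow_of_le_one (norm_nonneg q) hq.le he) (norm_nonneg _)

lemma summable_div_qPoch_mul {q : ℂ} (hq : ‖q‖ < 1) {e : ℕ → ℕ} (he : ∀ m, m ^ 2 ≤ e m)
    {z : ℕ → ℂ} {M : ℝ} (hz : ∀ m, ‖z m‖ ≤ M) :
    Summable fun m => q ^ e m / qPoch (q ^ 2) (q ^ 2) m * z m :=
  Summable.of_norm_bounded ((summable_gaussMajorant hq).mul_right M)
    fun m => norm_div_qPoch_mul_le hq (he m) (hz m)

lemma sq_le_level_exponent (d s l m : ℕ) : m ^ 2 ≤ (d + 1) * (m ^ 2 + s * m) + l * m := by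
  nlinarith [Nat.zero_le (d * (m ^ 2 + s * m)), Nat.zero_le (s * m), Nat.zero_le (l * m)]

lemma exists_norm_levelSum_le {q : ℂ} (hq : ‖q‖ < 1) (d : ℕ) :
    ∃ M : ℝ, ∀ a s, ‖levelSum q d a s‖ ≤ M := by
  induction d with
  | zero => exact ⟨1, fun a s => by simp only [levelSum]; split_ifs <;> simp⟩
  | succ d ih =>
    obtain ⟨M, hM⟩ := ih
    refine ⟨∑' m, gaussMajorant q m * M, fun a s => ?_⟩
    exact tsum_of_norm_bounded ((summable_gaussMajorant hq).mul_right M).hasSum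
      fun m => norm_div_qPoch_mul_le hq (sq_le_level_exponent d s _ m) (hM _ _)

lemma summable_levelSum_succ {q : ℂ} (hq : ‖q‖ < 1) (d a s l : ℕ) (t : ℕ → ℕ) :
    Summable fun m : ℕ => q ^ ((d + 1) * (m ^ 2 + s * m) + l * m) /
      qPoch (q ^ 2) (q ^ 2) m * levelSum q d a (t m) := by
  obtain ⟨M, hM⟩ := exists_norm_levelSum_le hq d
  exact summable_div_qPoch_mul hq (fun m => sq_le_level_exponent d s l m) fun m => hM _ _

/-- The telescoping identity behind the functional equation of `levelSum`. -/
lemma tsum_telescope {q : ℂ} (hq : ‖q‖ < 1) {a b s : ℕ} (hab : 0 < a + b) {f g h p : ℕ → ℂ} {M : ℝ}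
    (hf : ∀ m, ‖f m‖ ≤ M) (hg : ∀ m, ‖g m‖ ≤ M) (hp : ∀ m, ‖p m‖ ≤ M)
    (hfg : ∀ m, f m = g m + q ^ (a * (s + 2 * m + 1)) * h m)
    (hph : ∀ m, p m = h m + q ^ (b * (s + 2 * m + 2)) * g (m + 1)) :
    ∑' m, q ^ ((a + b) * (m ^ 2 + s * m) + b * m) / qPoch (q ^ 2) (q ^ 2) m * f m =
      ∑' m, q ^ ((a + b) * (m ^ 2 + s * m) + (b + 2) * m) / qPoch (q ^ 2) (q ^ 2) m * g m +
      q ^ (a * (s + 1)) *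
        ∑' m, q ^ ((a + b) * (m ^ 2 + (s + 1) * m) + a * m) / qPoch (q ^ 2) (q ^ 2) m * p m := by
  obtain ⟨c, hc⟩ : ∃ c, a + b = c + 1 := ⟨a + b - 1, by omega⟩
  have hle : ∀ t l m : ℕ, m ^ 2 ≤ (a + b) * (m ^ 2 + t * m) + l * m := fun t l m => by
    rw [hc]; exact sq_le_level_exponent c t l m
  have sA := summable_div_qPoch_mul hq (hle s b) hf
  have sC := summable_div_qPoch_mul hq (hle s (b + 2)) hg
  have sD := summable_div_qPoch_mul hq (hle (s + 1) a) hp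
  have sG := summable_div_qPoch_mul hq (hle s b) hg
  have sH := sG.sub sC
  have hH0 := sH.tsum_eq_zero_add
  have key : ∀ m, q ^ ((a + b) * (m ^ 2 + s * m) + b * m) / qPoch (q ^ 2) (q ^ 2) m * f m +
      (q ^ ((a + b) * ((m + 1) ^ 2 + s * (m + 1)) + b * (m + 1)) / qPoch (q ^ 2) (q ^ 2) (m + 1)
          * g (m + 1) -
        q ^ ((a + b) * ((m + 1) ^ 2 + s * (m + 1)) + (b + 2) * (m + 1)) /
          qPoch (q ^ 2) (q ^ 2) (m + 1) * g (m + 1)) =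
      q ^ ((a + b) * (m ^ 2 + s * m) + b * m) / qPoch (q ^ 2) (q ^ 2) m * g m +
      q ^ (a * (s + 1)) *
        (q ^ ((a + b) * (m ^ 2 + (s + 1) * m) + a * m) / qPoch (q ^ 2) (q ^ 2) m * p m) := by
    intro m
    have hP := qPoch_sq_ne_zero hq m
    have hF : 1 - q ^ 2 * (q ^ 2) ^ m ≠ 0 := by
      have := qPoch_sq_ne_zero hq (m + 1)
      rw [qPoch_succ] at this
      exact right_ne_zero_of_mul this
    rw [hph, hfg, qPoch_succ]
    field_simp
    ring
  have hsum := tsum_congr (L := .unconditional ℕ) key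
  rw [Summable.tsum_add sA ((summable_nat_add_iff 1).mpr sH), Summable.tsum_add sG (sD.mul_left _),
    tsum_mul_left] at hsum
  have hsub := sG.tsum_sub sC
  simp only [ne_eq, OfNat.ofNat_ne_zero, not_false_eq_true, zero_pow, mul_zero, add_zero, sub_self,
    zero_add] at hH0
  linear_combination hsum + hH0 - hsub

lemma linCoeff_eq_of_lt {D a s : ℕ} (h : D < a) : linCoeff D (a + 1) s = linCoeff D a s := by
  unfold linCoeff
  split_ifs <;> omega

/-- The functional equation of the iterated sums. -/
theorem levelSum_succ_index {q : ℂ} (hq : ‖q‖ < 1) (d a s : ℕ) :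
    levelSum q d (a + 1) s = levelSum q d a s +
      if Even s → Even a then q ^ (a * (s + 1)) * levelSum q d (d + 1 - a) (s + 1) else 0 := by
  induction d generalizing a s with
  | zero =>
    rcases Nat.eq_zero_or_pos a with rfl | ha
    · simp [levelSum]
    · have h0 : 0 + 1 - a = 0 := by omega
      simp [levelSum, h0, ha.ne']
  | succ d ih =>
    obtain ⟨M, hM⟩ := exists_norm_levelSum_le hq d
    rcases Nat.lt_or_ge (d + 1) a with hda | hda
    · have h0 : d + 1 + 1 - a = 0 := by omega
      have h0' : d + 1 - a = 0 := by omega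
      simp [levelSum, h0, h0', levelSum_zero_index, ih, linCoeff_eq_of_lt hda]
    obtain ⟨b, hb⟩ := Nat.exists_eq_add_of_le hda
    have hsh : ∀ m, Even (s + 2 * m) ↔ Even s := fun m => by simp [Nat.even_add]
    by_cases hmain : (Even s → Even a) ∧ (¬ Even s → Even b)
    · have l1 : linCoeff (d + 1) (a + 1) s = b := by
        unfold linCoeff; split_ifs with hs
        · have := hmain.1 hs; grind
        · have := hmain.2 hs; grind
      have l3 : linCoeff (d + 1) (b + 1) (s + 1) = a := by
        unfold linCoeff; split_ifs with hs
        · have := hmain.2 (by grind); grind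
        · have := hmain.1 (by grind); grind
      rw [if_pos hmain.1, show d + 1 + 1 - a = b + 1 by omega]
      simp only [levelSum]
      rw [l1, l3, hb]
      have e2 : ∑' m, q ^ ((a + b) * (m ^ 2 + s * m) + linCoeff (a + b) a s * m) /
            qPoch (q ^ 2) (q ^ 2) m * levelSum q d a (s + 2 * m) =
          ∑' m, q ^ ((a + b) * (m ^ 2 + s * m) + (b + 2) * m) /
            qPoch (q ^ 2) (q ^ 2) m * levelSum q d a (s + 2 * m) := by
        rcases Nat.eq_zero_or_pos a with rfl | ha
        · simp [levelSum_zero_index]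
        · have l2 : linCoeff (a + b) a s = b + 2 := by
            unfold linCoeff; split_ifs with hs
            · have := hmain.1 hs; grind
            · have := hmain.2 hs; grind
          rw [l2]
      rw [e2]
      refine tsum_telescope hq (by omega) (h := fun m => levelSum q d b (s + 2 * m + 1))
        (fun m => hM _ _) (fun m => hM _ _) (fun m => hM _ _) (fun m => ?_) (fun m => ?_)
      · rw [ih, if_pos (by rw [hsh]; exact hmain.1), show d + 1 - a = b by omega]
      · rw [show s + 1 + 2 * m = s + 2 * m + 1 by ring, ih, if_pos (by grind),
          show d + 1 - b = a by omega, show s + 2 * (m + 1) = s + 2 * m + 1 + 1 by ring]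
    · by_cases hc : Even s → Even a
      · have hs : ¬ Even s := fun h => hmain ⟨hc, fun h' => absurd h h'⟩
        have hbo : ¬ Even b := fun h => hmain ⟨hc, fun _ => h⟩
        have l1 : linCoeff (d + 1) (a + 1) s = b + 1 := by
          unfold linCoeff; grind
        have l2 : linCoeff (d + 1) a s = b + 1 := by
          unfold linCoeff; grind
        have l3 : linCoeff (d + 1) (b + 1) (s + 1) = a + 1 := by
          unfold linCoeff; grind
        rw [if_pos hc, show d + 1 + 1 - a = b + 1 by omega]
        simp only [levelSum]
        rw [l1, l2, l3, ← tsum_mul_left, ← Summable.tsum_add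
          (summable_levelSum_succ hq ..) ((summable_levelSum_succ hq ..).mul_left _)]
        refine tsum_congr fun m => ?_
        have hp : levelSum q d (b + 1) (s + 1 + 2 * m) = levelSum q d b (s + 2 * m + 1) := by
          rw [ih, if_neg (by grind), add_zero, show s + 1 + 2 * m = s + 2 * m + 1 by ring]
        rw [ih, if_pos (by rw [hsh]; exact hc), show d + 1 - a = b by omega, hp, hb]
        ring
      · rw [if_neg hc, add_zero]
        have l1 : linCoeff (d + 1) (a + 1) s = linCoeff (d + 1) a s := by
          unfold linCoeff; grind
        simp only [levelSum]
        rw [l1]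
        refine tsum_congr fun m => ?_
        rw [ih, if_neg (by rw [hsh]; exact hc), add_zero]

lemma tendsto_levelSum {q : ℂ} (hq : ‖q‖ < 1) (d : ℕ) {a : ℕ} (ha : a ≠ 0) :
    Filter.Tendsto (levelSum q d a) Filter.atTop (nhds 1) := by
  induction d with
  | zero => simp [levelSum, ha, tendsto_const_nhds_iff]
  | succ d ih =>
    obtain ⟨M, hM⟩ := exists_norm_levelSum_le hq d
    rw [← tsum_ite_eq (0 : ℕ) (fun _ => (1 : ℂ))]
    refine tendsto_tsum_of_dominated_convergence (bound := fun m => gaussMajorant q m * M)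
      ((summable_gaussMajorant hq).mul_right M) (fun m => ?_)
      (Filter.Eventually.of_forall fun s m =>
        norm_div_qPoch_mul_le hq (sq_le_level_exponent d s _ m) (hM _ _))
    rcases Nat.eq_zero_or_pos m with rfl | hm
    · simpa [qPoch] using ih
    · rw [if_neg hm.ne']
      have hpow : Filter.Tendsto (fun s : ℕ => ‖q‖ ^ s / ‖qPoch (q ^ 2) (q ^ 2) m‖ * M)
          Filter.atTop (nhds 0) := by
        simpa using ((tendsto_pow_atTop_nhds_zero_of_lt_one (norm_nonneg q) hq).div_const
          ‖qPoch (q ^ 2) (q ^ 2) m‖).mul_const M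
      refine squeeze_zero_norm (fun s => ?_) hpow
      rw [norm_mul, norm_div, norm_pow]
      refine mul_le_mul ?_ (hM _ _) (norm_nonneg _) (by positivity)
      refine div_le_div_of_nonneg_right (pow_le_pow_of_le_one (norm_nonneg q) hq.le ?_)
        (norm_nonneg _)
      have : s ≤ s * m := Nat.le_mul_of_pos_right s hm
      nlinarith [Nat.zero_le (d * (m ^ 2 + s * m)), Nat.zero_le (m ^ 2),
        Nat.zero_le (linCoeff (d + 1) a s * m)]

lemma levelSum_eq_sum {q : ℂ} (hq : ‖q‖ < 1) (d a s : ℕ) :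
    levelSum q d a s = ∑ j ∈ range a with (Even s → Even j),
      q ^ (j * (s + 1)) * levelSum q d (d + 1 - j) (s + 1) := by
  induction a with
  | zero => simp [levelSum_zero_index]
  | succ a ih => rw [levelSum_succ_index hq, ih, sum_filter, sum_filter, sum_range_succ]

/-- The generating polynomial of admissible partitions with parts in `(s, s + t]`, where the
part `s + 1` occurs fewer than `a` times and consecutive multiplicities sum to at most `d`. -/
noncomputable def boundedGF (q : ℂ) (d : ℕ) : ℕ → ℕ → ℕ → ℂ
  | 0, a, _ => if a = 0 then 0 else 1
  | t + 1, a, s => ∑ j ∈ range a with (Even s → Even j),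
      q ^ (j * (s + 1)) * boundedGF q d t (d + 1 - j) (s + 1)

lemma norm_levelSum_sub_boundedGF_le {q : ℂ} (hq : ‖q‖ < 1) {d S : ℕ} {ε : ℝ} (hε : 0 ≤ ε)
    (hS : ∀ s, S ≤ s → ∀ a ≤ d + 1, ‖levelSum q d a s - boundedGF q d 0 a s‖ ≤ ε)
    (t a s : ℕ) (ha : a ≤ d + 1) (hst : S ≤ s + t) :
    ‖levelSum q d a s - boundedGF q d t a s‖ ≤ Real.exp (d * ‖q‖ ^ (s + 1) / (1 - ‖q‖)) * ε := by
  have hr : 0 < 1 - ‖q‖ := by linarith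
  induction t generalizing a s with
  | zero =>
    refine (hS s hst a ha).trans (le_mul_of_one_le_left hε (Real.one_le_exp (by positivity)))
  | succ t ih =>
    set C := Real.exp (d * ‖q‖ ^ (s + 1 + 1) / (1 - ‖q‖)) * ε with hC
    have hC0 : 0 ≤ C := by positivity
    rw [levelSum_eq_sum hq, boundedGF, ← sum_sub_distrib]
    calc _ ≤ ∑ j ∈ range a with (Even s → Even j), ‖q‖ ^ (j * (s + 1)) * C := by
          refine (norm_sum_le _ _).trans (sum_le_sum fun j _ => ?_)
          rw [← mul_sub, norm_mul, norm_pow]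
          exact mul_le_mul_of_nonneg_left (ih _ _ (by omega) (by omega)) (by positivity)
      _ ≤ ∑ j ∈ range (d + 1), ‖q‖ ^ (j * (s + 1)) * C := by
          refine sum_le_sum_of_subset_of_nonneg ?_ fun _ _ _ => by positivity
          exact (filter_subset _ _).trans (range_subset_range.mpr ha)
      _ ≤ (1 + d * ‖q‖ ^ (s + 1)) * C := by
          rw [← sum_mul, sum_range_succ']
          refine mul_le_mul_of_nonneg_right ?_ hC0
          have : ∑ j ∈ range d, ‖q‖ ^ ((j + 1) * (s + 1)) ≤ ∑ j ∈ range d, ‖q‖ ^ (s + 1) :=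
            sum_le_sum fun j _ => pow_le_pow_of_le_one (norm_nonneg q) hq.le
              (Nat.le_mul_of_pos_left _ j.succ_pos)
          simp only [sum_const, card_range, nsmul_eq_mul] at this
          simp only [zero_mul, pow_zero]
          linarith
      _ ≤ Real.exp (d * ‖q‖ ^ (s + 1)) * C := by
          refine mul_le_mul_of_nonneg_right ?_ hC0
          linarith [Real.add_one_le_exp (d * ‖q‖ ^ (s + 1))]
      _ = _ := by
          rw [hC, ← mul_assoc, ← Real.exp_add]
          congr 2
          field_simp
          ring

theorem tendsto_boundedGF {q : ℂ} (hq : ‖q‖ < 1) {d a : ℕ} (ha : a ≤ d + 1) (s : ℕ) :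
    Filter.Tendsto (fun t => boundedGF q d t a s) Filter.atTop (nhds (levelSum q d a s)) := by
  have hbase : ∀ ε > 0, ∃ S, ∀ s, S ≤ s → ∀ a ≤ d + 1,
      ‖levelSum q d a s - boundedGF q d 0 a s‖ ≤ ε := by
    intro ε hε
    have h1 : ∀ a : ℕ, ∀ᶠ s in Filter.atTop, ‖levelSum q d a s - boundedGF q d 0 a s‖ ≤ ε := by
      intro a
      rcases eq_or_ne a 0 with rfl | ha0
      · simp [levelSum_zero_index, boundedGF, hε.le]
      · have h2 := (tendsto_levelSum hq d ha0).sub_const 1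
        have h3 := h2.norm
        simp only [sub_self, norm_zero] at h3
        simpa [boundedGF, ha0] using h3.eventually_le_const hε
    have h2 : ∀ᶠ s in Filter.atTop, ∀ a ∈ range (d + 2),
        ‖levelSum q d a s - boundedGF q d 0 a s‖ ≤ ε :=
      (Filter.eventually_all_finset _).mpr fun a _ => h1 a
    obtain ⟨S, hS⟩ := Filter.eventually_atTop.mp h2
    exact ⟨S, fun s hs a ha => hS s hs a (mem_range.mpr (by omega))⟩
  set E := Real.exp (d * ‖q‖ ^ (s + 1) / (1 - ‖q‖)) with hE
  have hE0 : 0 < E := Real.exp_pos _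
  refine Metric.tendsto_atTop.mpr fun ε hε => ?_
  obtain ⟨S, hS⟩ := hbase (ε / (2 * E)) (by positivity)
  refine ⟨S, fun t ht => ?_⟩
  rw [dist_comm, dist_eq_norm]
  refine (norm_levelSum_sub_boundedGF_le hq (by positivity) hS t a s ha (by omega)).trans_lt ?_
  rw [← hE, show E * (ε / (2 * E)) = ε / 2 by field_simp]
  linarith

/-- The exponent of `q` in the multisum with `x = q ^ s`. -/
def multisumExponent (a d s : ℕ) (n : Fin d → ℕ) : ℕ :=
  (∑ i ∈ Icc 1 d, Nsum d n i ^ 2) + s * (∑ i ∈ Icc 1 d, Nsum d n i) +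
    (∑ i ∈ (Icc 1 (a - 2)).filter (fun i => i % 2 = 1), (Nsum d n i - Nsum d n (i + 1))) +
    ∑ i ∈ Icc a d, Nsum d n i

lemma Nsum_snoc (d : ℕ) (n : Fin d → ℕ) (m i : ℕ) :
    Nsum (d + 1) (Fin.snoc n m) i = Nsum d n i + if i ≤ d + 1 then m else 0 := by
  simp [Nsum, Fin.sum_univ_castSucc]

lemma Nsum_eq_zero {d i : ℕ} (n : Fin d → ℕ) (h : d < i) : Nsum d n i = 0 :=
  Finset.sum_eq_zero fun j _ => if_neg (by omega)

lemma sum_Nsum_snoc_Icc (d a : ℕ) (n : Fin d → ℕ) (m : ℕ) :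
    ∑ i ∈ Icc a (d + 1), Nsum (d + 1) (Fin.snoc n m) i =
      (∑ i ∈ Icc a d, Nsum d n i) + (d + 2 - a) * m := by
  have h1 : ∑ i ∈ Icc a (d + 1), Nsum (d + 1) (Fin.snoc n m) i =
      ∑ i ∈ Icc a (d + 1), (Nsum d n i + m) :=
    sum_congr rfl fun i hi => by rw [Nsum_snoc, if_pos (mem_Icc.mp hi).2]
  have h2 : ∑ i ∈ Icc a (d + 1), Nsum d n i = ∑ i ∈ Icc a d, Nsum d n i := by
    refine (sum_subset (Icc_subset_Icc_right d.le_succ) fun i hi hi' => Nsum_eq_zero n ?_).symm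
    simp only [mem_Icc] at hi hi'
    omega
  rw [h1, sum_add_distrib, h2, sum_const, Nat.card_Icc, smul_eq_mul]

lemma sum_sq_Nsum_snoc (d : ℕ) (n : Fin d → ℕ) (m : ℕ) :
    ∑ i ∈ Icc 1 (d + 1), Nsum (d + 1) (Fin.snoc n m) i ^ 2 =
      (∑ i ∈ Icc 1 d, Nsum d n i ^ 2) + 2 * m * (∑ i ∈ Icc 1 d, Nsum d n i) + (d + 1) * m ^ 2 := by
  have h1 : ∀ i ∈ Icc 1 d, Nsum (d + 1) (Fin.snoc n m) i ^ 2 =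
      Nsum d n i ^ 2 + 2 * m * Nsum d n i + m ^ 2 := fun i hi => by
    rw [Nsum_snoc, if_pos (by have := (mem_Icc.mp hi).2; omega)]; ring
  rw [sum_Icc_succ_top (by omega), sum_congr rfl h1, sum_add_distrib, sum_add_distrib, ← mul_sum,
    Nsum_snoc, Nsum_eq_zero n d.lt_succ_self]
  simp
  ring

lemma sum_odd_Nsum_sub_snoc (d b : ℕ) (n : Fin d → ℕ) (m : ℕ) :
    ∑ i ∈ (Icc 1 b).filter (fun i => i % 2 = 1),
        (Nsum (d + 1) (Fin.snoc n m) i - Nsum (d + 1) (Fin.snoc n m) (i + 1)) =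
      (∑ i ∈ (Icc 1 b).filter (fun i => i % 2 = 1), (Nsum d n i - Nsum d n (i + 1))) +
        if d + 1 ≤ b ∧ (d + 1) % 2 = 1 then m else 0 := by
  have h1 : ∀ i, Nsum (d + 1) (Fin.snoc n m) i - Nsum (d + 1) (Fin.snoc n m) (i + 1) =
      (Nsum d n i - Nsum d n (i + 1)) + if d + 1 = i then m else 0 := fun i => by
    rw [Nsum_snoc, Nsum_snoc]
    rcases lt_trichotomy (d + 1) i with h | h | h
    · simp [h.ne, show ¬ i ≤ d + 1 by omega, show ¬ i ≤ d by omega]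
    · subst h
      simp [Nsum_eq_zero n]
    · rw [if_pos h.le, if_pos (Nat.succ_le_of_lt h), if_neg h.ne', Nat.add_sub_add_right, add_zero]
  simp_rw [h1]
  rw [sum_add_distrib, sum_ite_eq]
  simp

lemma multisumExponent_snoc {a s : ℕ} (ha : Odd a) (hs : Even s) (d m : ℕ) (n : Fin d → ℕ) :
    multisumExponent a (d + 1) s (Fin.snoc n m) =
      (d + 1) * (m ^ 2 + s * m) + linCoeff (d + 1) a s * m +
        multisumExponent a d (s + 2 * m) n := by
  have hl : linCoeff (d + 1) a s =
      (d + 2 - a) + if d + 1 ≤ a - 2 ∧ (d + 1) % 2 = 1 then 1 else 0 := by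
    rw [linCoeff, if_pos hs]
    obtain ⟨b, rfl⟩ := ha
    split_ifs <;> omega
  rw [hl]
  unfold multisumExponent
  rw [sum_sq_Nsum_snoc, sum_Nsum_snoc_Icc, sum_Nsum_snoc_Icc, sum_odd_Nsum_sub_snoc]
  rw [show d + 2 - 1 = d + 1 by omega]
  split_ifs <;> ring

/-- The summand of the multisum with `x = q ^ s`. -/
noncomputable def multisumTerm (q : ℂ) (a d s : ℕ) (n : Fin d → ℕ) : ℂ :=
  q ^ multisumExponent a d s n / ∏ j : Fin d, qPoch (q ^ 2) (q ^ 2) (n j)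

lemma multisumTerm_snoc (q : ℂ) {a s : ℕ} (ha : Odd a) (hs : Even s) (d m : ℕ) (n : Fin d → ℕ) :
    multisumTerm q a (d + 1) s (Fin.snoc n m) =
      q ^ ((d + 1) * (m ^ 2 + s * m) + linCoeff (d + 1) a s * m) / qPoch (q ^ 2) (q ^ 2) m *
        multisumTerm q a d (s + 2 * m) n := by
  rw [multisumTerm, multisumTerm, multisumExponent_snoc ha hs, Fin.prod_univ_castSucc, pow_add]
  simp only [Fin.snoc_castSucc, Fin.snoc_last]
  rw [mul_comm (∏ _, _), mul_div_mul_comm]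

lemma summable_prod_gaussMajorant {q : ℂ} (hq : ‖q‖ < 1) (d : ℕ) :
    Summable fun n : Fin d → ℕ => ∏ j, gaussMajorant q (n j) := by
  induction d with
  | zero => exact (hasSum_fintype _).summable
  | succ d ih =>
    rw [← (Fin.snocEquiv fun _ : Fin (d + 1) => ℕ).summable_iff]
    refine ((summable_gaussMajorant hq).mul_of_nonneg ih (gaussMajorant_nonneg q)
      fun n => prod_nonneg fun j _ => gaussMajorant_nonneg q _).congr fun x => ?_
    simp [Fin.prod_univ_castSucc, mul_comm]

lemma norm_multisumTerm_le {q : ℂ} (hq : ‖q‖ < 1) {a s : ℕ} (ha : Odd a) (hs : Even s) (d : ℕ)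
    (n : Fin d → ℕ) : ‖multisumTerm q a d s n‖ ≤ ∏ j, gaussMajorant q (n j) := by
  induction d generalizing s with
  | zero =>
    simp [multisumTerm, multisumExponent, Nsum]
  | succ d ih =>
    obtain ⟨n, m, rfl⟩ : ∃ n' m, n = Fin.snoc n' m :=
      ⟨Fin.init n, n (Fin.last d), (Fin.snoc_init_self n).symm⟩
    rw [multisumTerm_snoc q ha hs, Fin.prod_univ_castSucc]
    simp only [Fin.snoc_castSucc, Fin.snoc_last]
    rw [mul_comm (∏ _, _)]
    exact norm_div_qPoch_mul_le hq (sq_le_level_exponent ..)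
      (ih (hs.add (even_two_mul m)) n)

theorem hasSum_multisumTerm {q : ℂ} (hq : ‖q‖ < 1) {a s : ℕ} (ha : Odd a) (hs : Even s) (d : ℕ) :
    HasSum (multisumTerm q a d s) (levelSum q d a s) := by
  induction d generalizing s with
  | zero =>
    have ha0 : a ≠ 0 := by rintro rfl; simp at ha
    have := hasSum_fintype (multisumTerm q a 0 s)
    simpa [multisumTerm, multisumExponent, Nsum, levelSum, ha0] using this
  | succ d ih =>
    have hsumm : Summable (multisumTerm q a (d + 1) s) :=
      Summable.of_norm_bounded (summable_prod_gaussMajorant hq _)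
        fun n => norm_multisumTerm_le hq ha hs _ n
    rw [← (Fin.snocEquiv fun _ : Fin (d + 1) => ℕ).summable_iff] at hsumm
    rw [← (Fin.snocEquiv fun _ : Fin (d + 1) => ℕ).hasSum_iff]
    convert hsumm.hasSum using 1
    rw [hsumm.tsum_prod]
    simp only [levelSum]
    refine tsum_congr fun m => ?_
    rw [← (ih (hs.add (even_two_mul m))).tsum_eq, ← tsum_mul_left]
    exact tsum_congr fun n => (multisumTerm_snoc q ha hs d m n).symm

/-- Admissible multisets with all parts in `(s, s + t]`. -/
def admissible (d : ℕ) : ℕ → ℕ → ℕ → Finset (Multiset ℕ)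
  | 0, a, _ => if a = 0 then ∅ else {0}
  | t + 1, a, s => ((range a).filter fun j => Even s → Even j).biUnion fun j =>
      (admissible d t (d + 1 - j) (s + 1)).image fun M => Multiset.replicate j (s + 1) + M

lemma mem_admissible {d t a s : ℕ} (ha : a ≤ d + 1) (M : Multiset ℕ) :
    M ∈ admissible d t a s ↔ (∀ x ∈ M, s < x ∧ x ≤ s + t) ∧ M.count (s + 1) < a ∧
      (∀ x, s < x → M.count x + M.count (x + 1) ≤ d) ∧ ∀ x, Odd x → Even (M.count x) := by
  induction t generalizing a s M with
  | zero =>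
    rcases eq_or_ne a 0 with rfl | ha0
    · simp [admissible]
    · simp only [admissible, if_neg ha0, mem_singleton]
      constructor
      · rintro rfl
        simpa using Nat.pos_of_ne_zero ha0
      · rintro ⟨h, -⟩
        refine Multiset.eq_zero_of_forall_notMem fun x hx => ?_
        have := h x hx
        omega
  | succ t ih =>
    simp only [admissible, mem_biUnion, mem_filter, mem_range, mem_image]
    constructor
    · rintro ⟨j, ⟨hj, hjs⟩, N, hN, rfl⟩
      rw [ih (by omega)] at hN
      obtain ⟨h1, h2, h3, h4⟩ := hN
      have h0 : N.count (s + 1) = 0 := Multiset.count_eq_zero.mpr fun h => by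
        have := h1 _ h; omega
      refine ⟨fun x hx => ?_, ?_, fun x hx => ?_, fun x hx => ?_⟩
      · rcases Multiset.mem_add.mp hx with hx | hx
        · rw [Multiset.eq_of_mem_replicate hx]; omega
        · have := h1 x hx; omega
      · simpa [Multiset.count_replicate, h0] using hj
      · simp only [Multiset.count_add, Multiset.count_replicate]
        rcases eq_or_ne x (s + 1) with rfl | hx'
        · simp only [h0]; simp; omega
        · have := h3 x (by omega)
          rw [if_neg (by omega), if_neg (by omega)]
          omega
      · simp only [Multiset.count_add, Multiset.count_replicate]
        rcases eq_or_ne (s + 1) x with rfl | hx'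
        · simp only [h0, if_true, add_zero]
          exact hjs (by grind)
        · simpa [hx'] using h4 x hx
    · rintro ⟨h1, h2, h3, h4⟩
      have hsplit : Multiset.replicate (M.count (s + 1)) (s + 1) + M.filter (· ≠ s + 1) = M := by
        rw [← Multiset.filter_eq', Multiset.filter_add_not]
      refine ⟨M.count (s + 1), ⟨h2, fun hs => h4 _ hs.add_one⟩, M.filter (· ≠ s + 1), ?_, hsplit⟩
      have hcount : ∀ x, x ≠ s + 1 → (M.filter (· ≠ s + 1)).count x = M.count x := fun x hx =>
        Multiset.count_filter_of_pos hx
      have hcount' : (M.filter (· ≠ s + 1)).count (s + 1) = 0 :=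
        Multiset.count_filter_of_neg (by simp)
      rw [ih (by omega)]
      refine ⟨fun x hx => ?_, ?_, fun x hx => ?_, fun x hx => ?_⟩
      · obtain ⟨hx1, hx2⟩ := Multiset.mem_filter.mp hx
        have := h1 x hx1
        omega
      · rw [hcount _ (by omega)]
        have := h3 (s + 1) (by omega)
        omega
      · rw [hcount _ (by omega), hcount _ (by omega)]
        exact h3 x (by omega)
      · rcases eq_or_ne x (s + 1) with rfl | hx'
        · rw [hcount']; exact Even.zero
        · rw [hcount x hx']; exact h4 x hx

lemma sum_admissible (q : ℂ) {d t a s : ℕ} (ha : a ≤ d + 1) :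
    ∑ M ∈ admissible d t a s, q ^ M.sum = boundedGF q d t a s := by
  induction t generalizing a s with
  | zero => by_cases h : a = 0 <;> simp [admissible, boundedGF, h]
  | succ t ih =>
    have hcount : ∀ j, ∀ M ∈ (admissible d t (d + 1 - j) (s + 1)).image
        (fun M => Multiset.replicate j (s + 1) + M), M.count (s + 1) = j := by
      intro j M hM
      obtain ⟨N, hN, rfl⟩ := mem_image.mp hM
      have h0 : N.count (s + 1) = 0 := Multiset.count_eq_zero.mpr fun h => by
        have := ((mem_admissible (by omega) N).mp hN).1 _ h; omega
      simp [h0]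
    rw [admissible, boundedGF, sum_biUnion]
    · refine sum_congr rfl fun j _ => ?_
      rw [sum_image fun M _ N _ h => add_left_cancel h, ← ih (by omega), mul_sum]
      refine sum_congr rfl fun M _ => ?_
      rw [Multiset.sum_add, Multiset.sum_replicate, smul_eq_mul, pow_add]
    · intro i _ j _ hij
      refine disjoint_left.mpr fun M hi hj => hij ?_
      rw [← hcount i M hi, hcount j M hj]

/-- The condition on the parts of a partition counted by `OW_{k,a}`. -/
def IsOWParts (k a : ℕ) (M : Multiset ℕ) : Prop :=
  M.count 1 ≤ a - 1 ∧ (∀ i : ℕ, 1 ≤ i → M.count i + M.count (i + 1) ≤ k - 1) ∧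
    ∀ j : ℕ, 1 ≤ j → Even (M.count (2 * j - 1))

lemma mem_admissible_iff_isOWParts {k a t : ℕ} (ha : 1 ≤ a) (hak : a ≤ k) (M : Multiset ℕ) :
    M ∈ admissible (k - 1) t a 0 ↔ (∀ x ∈ M, 0 < x ∧ x ≤ t) ∧ IsOWParts k a M := by
  rw [mem_admissible (by omega), IsOWParts]
  have hodd : (∀ x, Odd x → Even (M.count x)) ↔ ∀ j : ℕ, 1 ≤ j → Even (M.count (2 * j - 1)) := by
    constructor
    · exact fun h j hj => h _ (by grind)
    · rintro h x ⟨y, rfl⟩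
      exact h (y + 1) (by omega)
  rw [hodd, zero_add, zero_add, Nat.lt_iff_le_pred ha]
  rfl

/-- The multisets of positive integers counted by `OW_{k,a}`, graded by their sum. -/
def owPartsEquiv (k a : ℕ) :
    (Σ n : ℕ, {P : n.Partition // IsOWParts k a P.parts}) ≃
      {M : Multiset ℕ // (∀ x ∈ M, 0 < x) ∧ IsOWParts k a M} where
  toFun P := ⟨P.2.1.parts, fun _ hx => P.2.1.parts_pos hx, P.2.2⟩
  invFun M := ⟨M.1.sum, ⟨M.1, fun {_} hx => M.2.1 _ hx, rfl⟩, M.2.2⟩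
  left_inv := by
    rintro ⟨n, ⟨M, hM, rfl⟩, h⟩
    rfl
  right_inv _ := rfl

theorem hasSum_isOWParts {k a : ℕ} (ha : 1 ≤ a) (hak : a ≤ k) {q : ℂ} (hq : ‖q‖ < 1) :
    HasSum (fun M : {M : Multiset ℕ // (∀ x ∈ M, 0 < x) ∧ IsOWParts k a M} => q ^ M.1.sum)
      (levelSum q (k - 1) a 0) := by
  classical
  set X : ℕ → Finset {M : Multiset ℕ // (∀ x ∈ M, 0 < x) ∧ IsOWParts k a M} :=
    fun t => (admissible (k - 1) t a 0).subtype _ with hX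
  have hmem : ∀ t M, M ∈ X t ↔ ∀ x ∈ M.1, x ≤ t := fun t M => by
    rw [hX, mem_subtype, mem_admissible_iff_isOWParts ha hak]
    exact ⟨fun h x hx => (h.1 x hx).2, fun h => ⟨fun x hx => ⟨M.2.1 x hx, h x hx⟩, M.2.2⟩⟩
  have hlim : Filter.Tendsto X Filter.atTop Filter.atTop := by
    refine Filter.tendsto_atTop_finset_of_monotone (fun t u htu M hM => ?_) fun M => ?_
    · rw [hmem] at hM ⊢
      exact fun x hx => (hM x hx).trans htu
    · exact ⟨M.1.sum, (hmem _ _).mpr fun x hx => Multiset.single_le_sum (by simp) _ hx⟩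
  have hsum : ∀ (z : ℂ) (t : ℕ), ∑ M ∈ X t, z ^ M.1.sum = boundedGF z (k - 1) t a 0 := by
    intro z t
    rw [← sum_admissible z (by omega), hX]
    refine sum_subtype_of_mem (fun M : Multiset ℕ => z ^ M.sum) fun M hM => ?_
    have := (mem_admissible_iff_isOWParts ha hak M).mp hM
    exact ⟨fun x hx => (this.1 x hx).1, this.2⟩
  have htend : ∀ z : ℂ, ‖z‖ < 1 → Filter.Tendsto (fun t => ∑ M ∈ X t, z ^ M.1.sum) Filter.atTop
      (nhds (levelSum z (k - 1) a 0)) := fun z hz => by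
    simp_rw [hsum]
    exact tendsto_boundedGF hz (by omega) 0
  have hsummable : Summable
      fun M : {M : Multiset ℕ // (∀ x ∈ M, 0 < x) ∧ IsOWParts k a M} => q ^ M.1.sum := by
    have hr : ‖((‖q‖ : ℝ) : ℂ)‖ < 1 := by simpa using hq
    obtain ⟨C, hC⟩ := (htend _ hr).norm.bddAbove_range
    refine Summable.of_norm (summable_of_sum_le (c := C) (fun _ => norm_nonneg _) fun u => ?_)
    obtain ⟨t, ht⟩ := (hlim.eventually_ge_atTop u).exists
    refine (sum_le_sum_of_subset_of_nonneg ht fun _ _ _ => norm_nonneg _).trans ?_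
    refine le_trans (le_of_eq ?_) (hC ⟨t, rfl⟩)
    simp only [norm_pow, ← Complex.ofReal_pow, ← Complex.ofReal_sum]
    rw [Complex.norm_real, Real.norm_of_nonneg (sum_nonneg fun _ _ => by positivity)]
  have h1 := hsummable.hasSum
  rwa [tendsto_nhds_unique (h1.comp hlim) (htend q hq)] at h1

theorem hasSum_card_isOWParts {k a : ℕ} (ha : 1 ≤ a) (hak : a ≤ k) {q : ℂ} (hq : ‖q‖ < 1) :
    HasSum (fun n : ℕ => (Nat.card {P : n.Partition // IsOWParts k a P.parts} : ℂ) * q ^ n)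
      (levelSum q (k - 1) a 0) := by
  have h := (owPartsEquiv k a).hasSum_iff.mpr (hasSum_isOWParts ha hak hq)
  refine h.sigma fun n => ?_
  classical
  convert hasSum_fintype _ using 1
  rw [Nat.card_eq_fintype_card, ← nsmul_eq_mul, ← card_univ, ← sum_const]
  refine sum_congr rfl fun P _ => ?_
  simp [owPartsEquiv, P.1.parts_sum]

/-- Multisum generating function for `\overline{W}_{k,a}(n)` when `k` is even and `a`
is odd (Kurşungöz; Kim–Yee). -/
theorem OW_multisum_k_even_a_odd (k a : ℕ) (ha : 1 ≤ a) (hak : a ≤ k)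
    (hk : Even k) (haodd : Odd a) (q : ℂ) (hq : ‖q‖ < 1) :
    Summable (fun n : ℕ =>
      (Nat.card {P : n.Partition //
          P.parts.count 1 ≤ a - 1 ∧
          (∀ i : ℕ, 1 ≤ i → P.parts.count i + P.parts.count (i + 1) ≤ k - 1) ∧
          ∀ j : ℕ, 1 ≤ j → Even (P.parts.count (2 * j - 1))} : ℂ) * q ^ n) ∧
    Summable (owTerm k a q) ∧
    ∑' n : ℕ,
      (Nat.card {P : n.Partition //
          P.parts.count 1 ≤ a - 1 ∧
          (∀ i : ℕ, 1 ≤ i → P.parts.count i + P.parts.count (i + 1) ≤ k - 1) ∧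
          ∀ j : ℕ, 1 ≤ j → Even (P.parts.count (2 * j - 1))} : ℂ) * q ^ n =
      ∑' n : Fin (k - 1) → ℕ, owTerm k a q n := by
  have hL := hasSum_card_isOWParts ha hak hq
  have hR : HasSum (owTerm k a q) (levelSum q (k - 1) a 0) := by
    have hterm : owTerm k a q = multisumTerm q a (k - 1) 0 := by
      funext n
      simp [owTerm, multisumTerm, multisumExponent]
    exact hterm ▸ hasSum_multisumTerm hq haodd Even.zero (k - 1)
  exact ⟨hL.summable, hR.summable, hL.tsum_eq.trans hR.tsum_eq.symm⟩
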